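/- arXiv:2406.11351 — 2 statements merged into one kernel-verified Lean document; each statement's English description precedes it below -/
import Mathlib

section
/- (Forward direction of the finite-run correspondence, by induction on the approximation level) Let σ be a system of equations in normal form, 𝒜 the k-BRA constructed from σ, and u^ℓ = F_{σ,w}^ℓ(∅) the ℓ-th iterate of the variable updating mapping from the empty environment. Then for every ℓ ≥ 0, positions i ≤ j, assignments θ, θ′, V ∈ Var and x ∈ Var_ω: w,i,θ,j,θ′,x ⊨_{u^ℓ} V implies (σ(V),θ,w[i..]) ⊢*_𝒜 (σ(x),θ′,w[j..]) and σ(x) ∈ F. -/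
namespace MuCal

/-- Basic formulas Φ_k over atomic propositions `At` and `k` registers. -/
inductive Phi (At : Type) (k : ℕ) : Type
  | tt : Phi At k
  | ff : Phi At k
  | pos : At → Phi At k
  | npos : At → Phi At k
  | up : Fin k → Phi At k
  | nup : Fin k → Phi At k
  | conj : Phi At k → Phi At k → Phi At k

/-- LTL↓dω formulas over variables `Var`. -/
inductive Fml (At : Type) (k : ℕ) (Var : Type) : Type
  | var : Var → Fml At k Var
  | or : Fml At k Var → Fml At k Var → Fml At k Var
  | dX : Finset (Fin k) → Fml At k Var → Phi At k → Fml At k Var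
  | tt : Fml At k Var

variable {At D Q Var : Type} {k : ℕ}

/-- θ[R←d] : update the registers in `R` to hold `d`. -/
def updA (θ : Fin k → D) (R : Finset (Fin k)) (d : D) : Fin k → D :=
  fun r => if r ∈ R then d else θ r

/-- Satisfaction of basic formulas: w,i,θ ⊨ φ. -/
def phiSat (w : ℕ → Set At × D) (i : ℕ) (θ : Fin k → D) : Phi At k → Prop
  | Phi.tt => True
  | Phi.ff => False
  | Phi.pos p => p ∈ (w i).1
  | Phi.npos p => p ∉ (w i).1
  | Phi.up r => θ r = (w i).2
  | Phi.nup r => θ r ≠ (w i).2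
  | Phi.conj φ₁ φ₂ => phiSat w i θ φ₁ ∧ phiSat w i θ φ₂

/-- Environments: each variable gets a set of 5-tuples (i,θ;j,θ′,x). -/
abbrev Env (D : Type) (k : ℕ) (Var : Type) : Type :=
  Var → Set (ℕ × (Fin k → D) × ℕ × (Fin k → D) × Var)

/-- The augmented relation w,i,θ,j,θ′,x ⊨_u ψ. -/
def aSat (vtt : Var) (w : ℕ → Set At × D) (u : Env D k Var) :
    Fml At k Var → ℕ → (Fin k → D) → ℕ → (Fin k → D) → Var → Prop
  | Fml.var V, i, θ, j, θ', x => (i, θ, j, θ', x) ∈ u V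
  | Fml.or ψ₁ ψ₂, i, θ, j, θ', x =>
      aSat vtt w u ψ₁ i θ j θ' x ∨ aSat vtt w u ψ₂ i θ j θ' x
  | Fml.dX R ψ φ, i, θ, j, θ', x =>
      i < j ∧ phiSat w i θ φ ∧ aSat vtt w u ψ (i + 1) (updA θ R (w i).2) j θ' x
  | Fml.tt, _, θ, _, θ', x => θ = θ' ∧ x = vtt

/-- A system of equations: σ with a main variable, ω-variables, and V_tt. -/
structure EqSys (At : Type) (k : ℕ) (Var : Type) where
  σ : Var → Fml At k Var
  main : Var
  omega : Set Var
  vtt : Var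

/-- Well-formedness conditions from Definition (system of equations):
V_tt ∈ Var_ω, σ(V_tt) = tt, and σ is injective on ω-variables. -/
def EqSys.WF (S : EqSys At k Var) : Prop :=
  S.vtt ∈ S.omega ∧ S.σ S.vtt = Fml.tt ∧
    ∀ V ∈ S.omega, ∀ V' : Var, S.σ V = S.σ V' → V = V'

/-- The variable updating mapping F_{σ,w}. -/
def Fmap (S : EqSys At k Var) (w : ℕ → Set At × D) (u : Env D k Var) : Env D k Var :=
  fun V =>
    {t | aSat S.vtt w u (S.σ V) t.1 t.2.1 t.2.2.1 t.2.2.2.1 t.2.2.2.2} ∪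
    {t | V ∈ S.omega ∧ ∃ (i : ℕ) (θ : Fin k → D), t = (i, θ, i, θ, V)}

/-- The least fixed point of F_{σ,w} (Knaster–Tarski form). -/
def lfpEnv (S : EqSys At k Var) (w : ℕ → Set At × D) : Env D k Var :=
  sInf {u | Fmap S w u ≤ u}

/-- w,i,θ ⊨_u V : an infinite chain of dependence through u exists. -/
def satVar (S : EqSys At k Var) (w : ℕ → Set At × D) (u : Env D k Var)
    (i : ℕ) (θ : Fin k → D) (V : Var) : Prop :=
  ∃ (I : ℕ → ℕ) (Θ : ℕ → Fin k → D) (X : ℕ → Var),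
    I 0 = i ∧ Θ 0 = θ ∧ X 0 = V ∧
    (∀ n, I n < I (n + 1)) ∧ (∀ n, X (n + 1) ∈ S.omega) ∧
    (∀ n, (I n, Θ n, I (n + 1), Θ (n + 1), X (n + 1)) ∈ u (X n))

/-- w ⊨ σ : w,1,⊥^k ⊨_{lfp(F_{σ,w})} V_main. -/
def sats (S : EqSys At k Var) (dbot : D) (w : ℕ → Set At × D) : Prop :=
  satVar S w (lfpEnv S w) 1 (fun _ => dbot) S.main

/-- Normal form: every equation is V = V′ ∨ V″, V = ↓_R X V′ ∧ φ, or V = tt. -/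
def InNormalForm (S : EqSys At k Var) : Prop :=
  ∀ V : Var,
    (∃ V₁ V₂ : Var, S.σ V = Fml.or (Fml.var V₁) (Fml.var V₂)) ∨
    (∃ (R : Finset (Fin k)) (V₁ : Var) (φ : Phi At k), S.σ V = Fml.dX R (Fml.var V₁) φ) ∨
    S.σ V = Fml.tt

/-- `IsDisj ψ s` : ψ is an iterated disjunction of exactly the variables in `s`. -/
inductive IsDisj {At : Type} {k : ℕ} {Var : Type} : Fml At k Var → Set Var → Prop
  | var (V : Var) : IsDisj (Fml.var V) {V}
  | or {ψ₁ ψ₂ : Fml At k Var} {s₁ s₂ : Set Var} :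
      IsDisj ψ₁ s₁ → IsDisj ψ₂ s₂ → IsDisj (Fml.or ψ₁ ψ₂) (s₁ ∪ s₂)

/-- A Büchi register automaton with k registers; `none` as guard means ε. -/
structure BRA (At : Type) (k : ℕ) (Q : Type) where
  q0 : Q
  δ : Set (Q × Option (Phi At k) × Finset (Fin k) × Q)
  acc : Set Q

/-- One transition step on IDs (q,θ,i), where i is the current position. -/
inductive BStep (A : BRA At k Q) (w : ℕ → Set At × D) :
    Q × (Fin k → D) × ℕ → Q × (Fin k → D) × ℕ → Prop
  | rule {q q' : Q} {φ : Phi At k} {R : Finset (Fin k)} {θ : Fin k → D} {i : ℕ} :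
      (q, some φ, R, q') ∈ A.δ → phiSat w i θ φ →
      BStep A w (q, θ, i) (q', updA θ R (w i).2, i + 1)
  | eps {q q' : Q} {θ : Fin k → D} {i : ℕ} :
      (q, none, (∅ : Finset (Fin k)), q') ∈ A.δ →
      BStep A w (q, θ, i) (q', θ, i)

/-- ⊢* : reflexive-transitive closure of the step relation. -/
def BSteps (A : BRA At k Q) (w : ℕ → Set At × D) :
    Q × (Fin k → D) × ℕ → Q × (Fin k → D) × ℕ → Prop :=
  Relation.ReflTransGen (BStep A w)

/-- Büchi acceptance: some accepting state is visited at infinitely many,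
strictly increasing positions, starting from (q₀, ⊥^k) at position 1. -/
def accepts (A : BRA At k Q) (dbot : D) (w : ℕ → Set At × D) : Prop :=
  ∃ qF ∈ A.acc, ∃ (I : ℕ → ℕ) (Θ : ℕ → Fin k → D),
    1 ≤ I 0 ∧ (∀ n, I n < I (n + 1)) ∧
    BSteps A w (A.q0, fun _ => dbot, 1) (qF, Θ 0, I 0) ∧
    ∀ n, BSteps A w (qF, Θ n, I n) (qF, Θ (n + 1), I (n + 1))

def lang (A : BRA At k Q) (dbot : D) : Set (ℕ → Set At × D) :=
  {w | accepts A dbot w}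

/-- The BRA constructed from a normal-form system σ (Theorem μ↓dω → BRA):
states are the formulas σ(V), initial state σ(V_t), accepting states σ(V_ω). -/
def toBRA (S : EqSys At k Var) : BRA At k (Fml At k Var) where
  q0 := S.σ S.main
  δ :=
    {t | t = (Fml.tt, some Phi.tt, (∅ : Finset (Fin k)), Fml.tt)} ∪
    {t | ∃ V V₁ V₂ : Var, S.σ V = Fml.or (Fml.var V₁) (Fml.var V₂) ∧
          (t = (S.σ V, none, (∅ : Finset (Fin k)), S.σ V₁) ∨
           t = (S.σ V, none, (∅ : Finset (Fin k)), S.σ V₂))} ∪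
    {t | ∃ (V : Var) (R : Finset (Fin k)) (V₁ : Var) (φ : Phi At k),
          S.σ V = Fml.dX R (Fml.var V₁) φ ∧ t = (S.σ V, some φ, R, S.σ V₁)}
  acc := S.σ '' S.omega

/-- Variables of the system constructed from a BRA:
V_q for q ∈ Q, V_r for r ∈ δ, and V_tt. -/
abbrev RVar (A : BRA At k Q) : Type := Q ⊕ ({r // r ∈ A.δ} ⊕ Unit)

/-- The BRA 𝒜′ obtained by applying the μ↓dω-to-BRA construction (with m-ary
disjunction states) to the system σ constructed from 𝒜. -/
def roundBRA (A : BRA At k Q) (S : EqSys At k (RVar A)) :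
    BRA At k (Fml At k (RVar A)) where
  q0 := S.σ (Sum.inl A.q0)
  δ :=
    {t | t = (Fml.tt, some Phi.tt, (∅ : Finset (Fin k)), Fml.tt)} ∪
    {t | ∃ (q : Q) (r : {r // r ∈ A.δ}), r.val.1 = q ∧
          t = (S.σ (Sum.inl q), none, (∅ : Finset (Fin k)), S.σ (Sum.inr (Sum.inl r)))} ∪
    {t | ∃ r : {r // r ∈ A.δ},
          t = (S.σ (Sum.inr (Sum.inl r)), r.val.2.1, r.val.2.2.1,
               S.σ (Sum.inl r.val.2.2.2))}
  acc := (fun q : Q => S.σ (Sum.inl q)) '' A.acc ∪ {Fml.tt}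

end MuCal

open MuCal

namespace MuCal

theorem updA_empty {D : Type} {k : ℕ} (θ : Fin k → D) (d : D) : updA θ ∅ d = θ := by
  funext r
  simp [updA]

/-- The state `tt` loops, so it can be carried forward to any later position. -/
theorem bSteps_toBRA_tt {At D Var : Type} {k : ℕ} (S : EqSys At k Var) (w : ℕ → Set At × D)
    (θ : Fin k → D) {i j : ℕ} (hij : i ≤ j) :
    BSteps (toBRA S) w (Fml.tt, θ, i) (Fml.tt, θ, j) := by
  induction j, hij using Nat.le_induction with
  | base => exact Relation.ReflTransGen.refl
  | succ n _ ih =>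
    have step : BStep (toBRA S) w (Fml.tt, θ, n) (Fml.tt, updA θ ∅ (w n).2, n + 1) :=
      BStep.rule (φ := Phi.tt) (Or.inl (Or.inl rfl)) trivial
    rw [updA_empty] at step
    exact ih.tail step

/-- Membership in an iterate of `Fmap` yields a run of the constructed automaton. -/
theorem bSteps_of_mem_iterate_Fmap {At D Var : Type} {k : ℕ} (S : EqSys At k Var)
    (htt : S.σ S.vtt = Fml.tt) (hNF : InNormalForm S) (w : ℕ → Set At × D)
    (ℓ i j : ℕ) (hij : i ≤ j) (θ θ' : Fin k → D) (V x : Var)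
    (h : (i, θ, j, θ', x) ∈ (Fmap S w)^[ℓ] (fun _ => ∅ : Env D k Var) V) :
    BSteps (toBRA S) w (S.σ V, θ, i) (S.σ x, θ', j) := by
  induction ℓ generalizing i θ V with
  | zero => exact h.elim
  | succ n ih =>
    rw [Function.iterate_succ_apply'] at h
    rcases h with h | ⟨-, i', θ₀, h⟩
    · simp only [Set.mem_ofPred_eq] at h
      rcases hNF V with ⟨V₁, V₂, hV⟩ | ⟨R, V₁, φ, hV⟩ | hV
      · rw [hV] at h
        rcases h with h | h
        · exact (ih i hij θ V₁ h).head
            (BStep.eps (Or.inl (Or.inr ⟨V, V₁, V₂, hV, Or.inl rfl⟩)))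
        · exact (ih i hij θ V₂ h).head
            (BStep.eps (Or.inl (Or.inr ⟨V, V₁, V₂, hV, Or.inr rfl⟩)))
      · rw [hV] at h
        obtain ⟨hlt, hφ, h⟩ := h
        exact (ih (i + 1) hlt _ V₁ h).head
          (BStep.rule (Or.inr ⟨V, R, V₁, φ, hV, rfl⟩) hφ)
      · rw [hV] at h
        obtain ⟨rfl, rfl⟩ := h
        rw [hV, htt]
        exact bSteps_toBRA_tt S w θ hij
    · simp only [Prod.mk.injEq] at h
      obtain ⟨rfl, rfl, rfl, rfl, rfl⟩ := h
      exact Relation.ReflTransGen.refl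

end MuCal

/-- Forward direction of the finite-run correspondence: for every
approximation level ℓ, w,i,θ,j,θ′,x ⊨_{F^ℓ(∅)} V implies a corresponding run of 𝒜. -/
theorem finite_run_forward (At D : Type) [Finite At] [Countable D] [Infinite D]
    (k : ℕ) (Var : Type) [Finite Var]
    (S : EqSys At k Var) (hWF : S.WF) (hNF : InNormalForm S)
    (w : ℕ → Set At × D) (ℓ : ℕ) (i j : ℕ) (hij : i ≤ j) (θ θ' : Fin k → D)
    (V : Var) (x : Var) (hx : x ∈ S.omega)
    (h : (i, θ, j, θ', x) ∈ (Fmap S w)^[ℓ] (fun _ => ∅ : Env D k Var) V) :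
    BSteps (toBRA S) w (S.σ V, θ, i) (S.σ x, θ', j) ∧ S.σ x ∈ (toBRA S).acc := by
  exact ⟨bSteps_of_mem_iterate_Fmap S hWF.2.1 hNF w ℓ i j hij θ θ' V x h, x, hx, rfl⟩
end

section
/- (Theorem: Büchi RA to μ↓dω-calculus) Let 𝒜 = (Q, q₀, δ, F) be a k-BRA without ε-rules in which every state has at least one outgoing transition rule. Define Var = {V_q | q ∈ Q} ∪ {V_r | r ∈ δ} ∪ {V_tt}, Var_ω = {V_q | q ∈ F} ∪ {V_tt}, and the system σ with main variable V_{q₀} given by: σ(V_q) = ⋁_{r ∈ δ|_q} V_r for each q ∈ Q (where δ|_q is the set of rules with source q), σ(V_r) = ↓_R X V_{q′} ∧ φ for each rule r = (q,φ,R) → q′ ∈ δ, and σ(V_tt) = tt. Then σ is equivalent to 𝒜: for every infinite data word w, w ⊨ σ iff w ∈ L(𝒜). -/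
open MuCal

namespace MuCal

theorem aSat_mono {At D Var : Type} {k : ℕ} {vtt : Var} {w : ℕ → Set At × D} {u v : Env D k Var}
    (h : u ≤ v) {ψ : Fml At k Var} {i j : ℕ} {θ θ' : Fin k → D} {x : Var}
    (hψ : aSat vtt w u ψ i θ j θ' x) : aSat vtt w v ψ i θ j θ' x := by
  induction ψ generalizing i θ with
  | var V => exact h V hψ
  | or ψ₁ ψ₂ ih₁ ih₂ => exact hψ.imp ih₁ ih₂
  | dX R ψ φ ih => exact ⟨hψ.1, hψ.2.1, ih hψ.2.2⟩
  | tt => exact hψ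

theorem Fmap_mono {At D Var : Type} {k : ℕ} (S : EqSys At k Var) (w : ℕ → Set At × D) :
    Monotone (Fmap S w) :=
  fun _ _ h _ => Set.union_subset_union_left _ fun _ ht => aSat_mono h ht

theorem Fmap_lfpEnv_le {At D Var : Type} {k : ℕ} (S : EqSys At k Var) (w : ℕ → Set At × D) :
    Fmap S w (lfpEnv S w) ≤ lfpEnv S w :=
  le_sInf fun _ hu => (Fmap_mono S w (sInf_le hu)).trans hu

theorem IsDisj.aSat_iff {At D Var : Type} {k : ℕ} {vtt : Var} {w : ℕ → Set At × D}
    {u : Env D k Var} {ψ : Fml At k Var} {s : Set Var} (h : IsDisj ψ s) {i j : ℕ}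
    {θ θ' : Fin k → D} {x : Var} :
    aSat vtt w u ψ i θ j θ' x ↔ ∃ V ∈ s, (i, θ, j, θ', x) ∈ u V := by
  induction h with
  | var V => simp [aSat]
  | or _ _ ih₁ ih₂ => simp only [aSat, ih₁, ih₂, Set.mem_union, or_and_right, exists_or]

theorem BSteps.le {At D Q : Type} {k : ℕ} {A : BRA At k Q} {w : ℕ → Set At × D}
    {a b : Q × (Fin k → D) × ℕ} (h : BSteps A w a b) : a.2.2 ≤ b.2.2 := by
  induction h with
  | refl => exact le_rfl
  | tail _ hs ih =>
    cases hs with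
    | rule => exact ih.trans (Nat.le_succ _)
    | eps => exact ih

/-- The environment of runs of `A` that end in an accepting state; the variable of a rule
stands for the runs from its source. -/
def runEnv {At D Q : Type} {k : ℕ} (A : BRA At k Q) (w : ℕ → Set At × D) : Env D k (RVar A) :=
  Sum.elim
    (fun q => {t | ∃ q' ∈ A.acc, t.2.2.2.2 = Sum.inl q' ∧
      BSteps A w (q, t.2.1, t.1) (q', t.2.2.2.1, t.2.2.1)})
    (Sum.elim
      (fun r => {t | ∃ q' ∈ A.acc, t.2.2.2.2 = Sum.inl q' ∧
        BSteps A w (r.val.1, t.2.1, t.1) (q', t.2.2.2.1, t.2.2.1)})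
      (fun _ => Set.univ))

section System

variable {At D Q : Type} {k : ℕ} {A : BRA At k Q} {S : EqSys At k (RVar A)}

theorem Fmap_runEnv_le
    (hNoEps : ∀ (q : Q) (R : Finset (Fin k)) (q' : Q), (q, none, R, q') ∉ A.δ)
    (homega : S.omega = Sum.inl '' A.acc ∪ {Sum.inr (Sum.inr ())})
    (hq : ∀ q : Q, IsDisj (S.σ (Sum.inl q))
        {V : RVar A | ∃ r : {r // r ∈ A.δ}, r.val.1 = q ∧ V = Sum.inr (Sum.inl r)})
    (hr : ∀ (r : {r // r ∈ A.δ}) (q : Q) (φ : Phi At k) (R : Finset (Fin k)) (q' : Q),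
        r.val = (q, some φ, R, q') →
        S.σ (Sum.inr (Sum.inl r)) = Fml.dX R (Fml.var (Sum.inl q')) φ)
    (w : ℕ → Set At × D) : Fmap S w (runEnv A w) ≤ runEnv A w := by
  rintro (q | ⟨⟨q, _ | φ, R, q'⟩, hmem⟩ | _) ⟨i, θ, j, θ', x⟩ ht
  · rcases ht with ht | ⟨hω, i', θ₁, heq⟩
    · obtain ⟨V, ⟨r, rfl, rfl⟩, h⟩ := (hq q).aSat_iff.1 ht
      exact h
    · obtain ⟨rfl, rfl, rfl, rfl, rfl⟩ : i = i' ∧ θ = θ₁ ∧ j = i' ∧ θ' = θ₁ ∧ x = Sum.inl q := by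
        simpa using heq
      exact ⟨q, by simpa [homega] using hω, rfl, Relation.ReflTransGen.refl⟩
  · exact absurd hmem (hNoEps q R q')
  · rcases ht with ht | ⟨hω, _⟩
    · rw [Set.mem_ofPred_eq, hr ⟨_, hmem⟩ q φ R q' rfl] at ht
      obtain ⟨-, hφ, p, hp, hx, hrun⟩ := ht
      exact ⟨p, hp, hx, Relation.ReflTransGen.head (BStep.rule hmem hφ) hrun⟩
    · simp [homega] at hω
  · trivial

theorem BSteps.mem_lfpEnv
    (hNoEps : ∀ (q : Q) (R : Finset (Fin k)) (q' : Q), (q, none, R, q') ∉ A.δ)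
    (homega : S.omega = Sum.inl '' A.acc ∪ {Sum.inr (Sum.inr ())})
    (hq : ∀ q : Q, IsDisj (S.σ (Sum.inl q))
        {V : RVar A | ∃ r : {r // r ∈ A.δ}, r.val.1 = q ∧ V = Sum.inr (Sum.inl r)})
    (hr : ∀ (r : {r // r ∈ A.δ}) (q : Q) (φ : Phi At k) (R : Finset (Fin k)) (q' : Q),
        r.val = (q, some φ, R, q') →
        S.σ (Sum.inr (Sum.inl r)) = Fml.dX R (Fml.var (Sum.inl q')) φ)
    {w : ℕ → Set At × D} {a b : Q × (Fin k → D) × ℕ} (hb : b.1 ∈ A.acc) (h : BSteps A w a b) :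
    (a.2.2, a.2.1, b.2.2, b.2.1, Sum.inl b.1) ∈ lfpEnv S w (Sum.inl a.1) := by
  induction h using Relation.ReflTransGen.head_induction_on with
  | refl => exact Fmap_lfpEnv_le S w _ (Or.inr ⟨by simpa [homega] using hb, _, _, rfl⟩)
  | head hs hrun ih =>
    cases hs with
    | @rule q q' φ R θ i hmem hφ =>
      refine Fmap_lfpEnv_le S w _ (Or.inl ((hq q).aSat_iff.2
        ⟨_, ⟨⟨_, hmem⟩, rfl, rfl⟩, Fmap_lfpEnv_le S w _ (Or.inl ?_)⟩))
      rw [Set.mem_ofPred_eq, hr ⟨_, hmem⟩ q φ R q' rfl]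
      exact ⟨BSteps.le hrun, hφ, ih⟩
    | eps hmem => exact absurd hmem (hNoEps _ _ _)

end System

/-- A run through infinitely many accepting states is accepting, as some state recurs. -/
theorem accepts_of_forall_bSteps {At D Q : Type} {k : ℕ} [Finite Q] {A : BRA At k Q} {dbot : D}
    {w : ℕ → Set At × D} {f : ℕ → Q} {I : ℕ → ℕ} {Θ : ℕ → Fin k → D} (hf : ∀ n, f n ∈ A.acc)
    (hI : StrictMono I) (h0 : BSteps A w (A.q0, fun _ => dbot, 1) (f 0, Θ 0, I 0))
    (hs : ∀ n, BSteps A w (f n, Θ n, I n) (f (n + 1), Θ (n + 1), I (n + 1))) :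
    accepts A dbot w := by
  have hle : ∀ {m n}, m ≤ n → BSteps A w (f m, Θ m, I m) (f n, Θ n, I n) := fun {m n} hmn => by
    induction n, hmn using Nat.le_induction with
    | base => exact Relation.ReflTransGen.refl
    | succ n _ ih => exact Relation.ReflTransGen.trans ih (hs n)
  obtain ⟨q, hinf⟩ := Finite.exists_infinite_fiber f
  have hinf : {n | f n = q}.Infinite := Set.infinite_coe_iff.1 hinf
  set g := Nat.nth fun n => f n = q
  have hg : ∀ n, f (g n) = q := Nat.nth_mem_of_infinite hinf
  have hmono : StrictMono g := Nat.nth_strictMono hinf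
  have hstart : BSteps A w (A.q0, fun _ => dbot, 1) (q, Θ (g 0), I (g 0)) :=
    hg 0 ▸ Relation.ReflTransGen.trans h0 (hle (Nat.zero_le _))
  refine ⟨q, hg 0 ▸ hf _, I ∘ g, Θ ∘ g, hstart.le, fun n => hI (hmono n.lt_succ_self), hstart,
    fun n => ?_⟩
  have h := hle (hmono n.lt_succ_self).le
  rwa [hg, hg] at h

end MuCal

/-- Theorem: Büchi RA to μ↓dω-calculus: the system σ constructed
from an ε-free k-BRA 𝒜 (every state having an outgoing rule), with V_q, V_r, V_tt,
Var_ω = {V_q | q ∈ F} ∪ {V_tt}, σ(V_q) = ⋁_{r ∈ δ|_q} V_r, σ(V_r) = ↓_R X V_{q′} ∧ φ,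
σ(V_tt) = tt, is equivalent to 𝒜. -/
theorem bra_to_mu (At D Q : Type) [Finite At] [Countable D] [Infinite D] (dbot : D)
    (k : ℕ) [Finite Q] (A : BRA At k Q)
    (hNoEps : ∀ (q : Q) (R : Finset (Fin k)) (q' : Q), (q, none, R, q') ∉ A.δ)
    (hOut : ∀ q : Q, ∃ (φ : Phi At k) (R : Finset (Fin k)) (q' : Q), (q, some φ, R, q') ∈ A.δ)
    (S : EqSys At k (RVar A))
    (hmain : S.main = Sum.inl A.q0)
    (hvtt : S.vtt = Sum.inr (Sum.inr ()))
    (homega : S.omega = Sum.inl '' A.acc ∪ {Sum.inr (Sum.inr ())})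
    (hq : ∀ q : Q, IsDisj (S.σ (Sum.inl q))
        {V : RVar A | ∃ r : {r // r ∈ A.δ}, r.val.1 = q ∧ V = Sum.inr (Sum.inl r)})
    (hr : ∀ (r : {r // r ∈ A.δ}) (q : Q) (φ : Phi At k) (R : Finset (Fin k)) (q' : Q),
        r.val = (q, some φ, R, q') →
        S.σ (Sum.inr (Sum.inl r)) = Fml.dX R (Fml.var (Sum.inl q')) φ)
    (htt : S.σ (Sum.inr (Sum.inr ())) = Fml.tt) :
    ∀ w : ℕ → Set At × D, sats S dbot w ↔ w ∈ lang A dbot := by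
  intro w
  constructor
  · rintro ⟨I, Θ, X, hI0, hΘ0, hX0, hI, -, hmem⟩
    have hrun : ∀ n q, X n = Sum.inl q → ∃ q' ∈ A.acc, X (n + 1) = Sum.inl q' ∧
        BSteps A w (q, Θ n, I n) (q', Θ (n + 1), I (n + 1)) := fun n q hX =>
      (sInf_le (Fmap_runEnv_le hNoEps homega hq hr w) : lfpEnv S w ≤ _) (Sum.inl q) (hX ▸ hmem n)
    have hacc : ∀ n, ∃ q ∈ A.acc, X (n + 1) = Sum.inl q := fun n => by
      induction n with
      | zero =>
        obtain ⟨q, hq, hX, -⟩ := hrun 0 A.q0 (hX0.trans hmain)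
        exact ⟨q, hq, hX⟩
      | succ n ih =>
        obtain ⟨p, -, hp⟩ := ih
        obtain ⟨q, hq, hX, -⟩ := hrun (n + 1) p hp
        exact ⟨q, hq, hX⟩
    choose f hf hX using hacc
    have hstep : ∀ n q, X n = Sum.inl q →
        BSteps A w (q, Θ n, I n) (f n, Θ (n + 1), I (n + 1)) := fun n q hn => by
      obtain ⟨q', -, hq', h⟩ := hrun n q hn
      rwa [Sum.inl.inj ((hX n).symm.trans hq')]
    have h0 := hstep 0 A.q0 (hX0.trans hmain)
    rw [hI0, hΘ0] at h0
    exact accepts_of_forall_bSteps (I := fun n => I (n + 1)) (Θ := fun n => Θ (n + 1)) hf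
      (strictMono_nat_of_lt_succ fun n => hI (n + 1)) h0 fun n => hstep (n + 1) (f n) (hX n)
  · rintro ⟨q, hqF, I, Θ, h1, hI, h0, hs⟩
    refine ⟨fun n => n.casesOn 1 fun m => I (m + 1),
      fun n => n.casesOn (fun _ => dbot) fun m => Θ (m + 1),
      fun n => n.casesOn (Sum.inl A.q0) fun _ => Sum.inl q, rfl, rfl, hmain.symm, ?_, ?_, ?_⟩
    · rintro (_ | n)
      · exact h1.trans_lt (hI 0)
      · exact hI (n + 1)
    · intro n
      simpa [homega] using hqF
    · rintro (_ | n)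
      · exact BSteps.mem_lfpEnv hNoEps homega hq hr (b := (q, _, _)) hqF
          (Relation.ReflTransGen.trans h0 (hs 0))
      · exact BSteps.mem_lfpEnv hNoEps homega hq hr (a := (q, _, _)) (b := (q, _, _)) hqF
          (hs (n + 1))
end
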